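/- arXiv:1012.1793 — 2 statements merged into one kernel-verified Lean document; each statement's English description precedes it below -/
import Mathlib

section
/- Let (Ω, F, (F_t)_{t≥0}, P) be a filtered probability space, let ρ : (0,∞) → (0,∞) be measurable with ∫_0^∞ ρ_s ds = 1, and for each s > 0 let (M_{ts})_{0≤t≤s} be a strictly positive (F_t)-martingale with M_{0s} = 1, such that (t,s,ω) ↦ M_{ts}(ω) is jointly measurable. Define π_t = ∫_t^∞ ρ_s M_{ts} ds. Then for all 0 ≤ t ≤ T, E[π_T | F_t] = ∫_T^∞ ρ_s M_{ts} ds almost surely; consequently the discount bond price P_{tT} := E[π_T | F_t] / π_t satisfies the rational formula P_{tT} = (∫_T^∞ ρ_s M_{ts} ds) / (∫_t^∞ ρ_s M_{ts} ds) almost surely. -/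
open MeasureTheory ProbabilityTheory Real

/-- Self-adjointness of conditional expectation against an indicator. -/
lemma FH_aux_selfadj {Ω : Type*} {m m0 : MeasurableSpace Ω} {P : Measure Ω}
    [IsProbabilityMeasure P] (hm : m ≤ m0) (g f : Ω → ℝ)
    (hg : Integrable g P) (hgb : ∀ᵐ ω ∂P, ‖g ω‖ ≤ 1)
    (hcb : ∀ᵐ ω ∂P, ‖(P[g | m]) ω‖ ≤ 1) (hf : Integrable f P) :
    ∫ ω, g ω * (P[f | m]) ω ∂P = ∫ ω, (P[g | m]) ω * f ω ∂P := by
  have hc : Integrable (P[g | m]) P := integrable_condExp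
  have h1 : Integrable ((P[g | m]) * f) P := hf.bdd_mul hc.1 hcb
  have h2 : Integrable (g * P[f | m]) P := (integrable_condExp).bdd_mul hg.1 hgb
  have e1 := condExp_mul_of_stronglyMeasurable_left (μ := P) (m := m)
    stronglyMeasurable_condExp h1 hf
  have e2 := condExp_mul_of_stronglyMeasurable_right (μ := P) (m := m)
    stronglyMeasurable_condExp h2 hg
  have i1 := integral_condExp (μ := P) (f := (P[g | m]) * f) hm
  have i2 := integral_condExp (μ := P) (f := g * P[f | m]) hm
  rw [integral_congr_ae e1] at i1
  rw [integral_congr_ae e2] at i2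
  exact i2.symm.trans i1

/-- Fubini against a bounded factor. -/
lemma FH_aux_swap {Ω : Type*} {m0 : MeasurableSpace Ω} {P : Measure Ω}
    [IsProbabilityMeasure P] (ν : Measure ℝ) [SFinite ν] (ρ : ℝ → ℝ) (N : ℝ → Ω → ℝ)
    (hN : Integrable (fun p : ℝ × Ω => ρ p.1 * N p.1 p.2) (ν.prod P))
    (g : Ω → ℝ) (hg : AEStronglyMeasurable g P) (hgb : ∀ᵐ ω ∂P, ‖g ω‖ ≤ 1) :
    ∫ ω, g ω * (∫ s, ρ s * N s ω ∂ν) ∂P = ∫ s, ρ s * ∫ ω, g ω * N s ω ∂P ∂ν := by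
  have h : Integrable (fun p : ℝ × Ω => g p.2 * (ρ p.1 * N p.1 p.2)) (ν.prod P) :=
    hN.bdd_mul hg.comp_snd (Measure.quasiMeasurePreserving_snd.ae hgb)
  have := integral_integral_swap (f := fun s ω => g ω * (ρ s * N s ω)) h
  simp_rw [← integral_const_mul]
  rw [← this]
  refine integral_congr_ae (.of_forall fun s => integral_congr_ae (.of_forall fun ω => ?_))
  simp only
  ring

/-- For the Flesaker–Hughston pricing kernel `π t = ∫_t^∞ ρ s * M t s ds`, one has
`E[π T | ℱ t] = ∫_T^∞ ρ s * M t s ds` a.s., and consequently the discount bond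
price `P_{tT} = E[π T | ℱ t] / π t` is given by the rational formula
`(∫_T^∞ ρ s * M t s ds) / (∫_t^∞ ρ s * M t s ds)` a.s. -/
theorem FH_bond_price_rational
    {Ω : Type*} {m0 : MeasurableSpace Ω} {P : Measure Ω} [IsProbabilityMeasure P]
    (ℱ : Filtration ℝ m0)
    (ρ : ℝ → ℝ) (hρmeas : Measurable ρ)
    (hρpos : ∀ s : ℝ, 0 < s → 0 < ρ s)
    (hρint : ∫ s in Set.Ioi (0 : ℝ), ρ s = 1)
    (M : ℝ → ℝ → Ω → ℝ)
    (hMmeas : Measurable fun p : ℝ × ℝ × Ω => M p.1 p.2.1 p.2.2)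
    (hMadapted : ∀ s t : ℝ, 0 < s → 0 ≤ t → t ≤ s → StronglyMeasurable[ℱ t] (M t s))
    (hMint : ∀ s t : ℝ, 0 < s → 0 ≤ t → t ≤ s → Integrable (M t s) P)
    (hMpos : ∀ s t : ℝ, 0 < s → 0 ≤ t → t ≤ s → ∀ᵐ ω ∂P, 0 < M t s ω)
    (hMinit : ∀ s : ℝ, 0 < s → ∀ᵐ ω ∂P, M 0 s ω = 1)
    (hMmart : ∀ s t u : ℝ, 0 < s → 0 ≤ t → t ≤ u → u ≤ s →
      P[M u s | ℱ t] =ᵐ[P] M t s) :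
    ∀ t T : ℝ, 0 ≤ t → t ≤ T →
      (P[fun ω => ∫ s in Set.Ioi T, ρ s * M T s ω | ℱ t]
          =ᵐ[P] fun ω => ∫ s in Set.Ioi T, ρ s * M t s ω) ∧
      (∀ᵐ ω ∂P,
        (P[fun ω' => ∫ s in Set.Ioi T, ρ s * M T s ω' | ℱ t]) ω
            / (∫ s in Set.Ioi t, ρ s * M t s ω)
          = (∫ s in Set.Ioi T, ρ s * M t s ω)
            / (∫ s in Set.Ioi t, ρ s * M t s ω)) := by
  intro t T ht htT
  have key : P[fun ω => ∫ s in Set.Ioi T, ρ s * M T s ω | ℱ t]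
          =ᵐ[P] fun ω => ∫ s in Set.Ioi T, ρ s * M t s ω := by
    have hT : 0 ≤ T := ht.trans htT
    have hρI : Integrable ρ (volume.restrict (Set.Ioi (0 : ℝ))) := by
      by_contra h
      rw [integral_undef h] at hρint
      exact zero_ne_one hρint
    have hρT : Integrable ρ (volume.restrict (Set.Ioi T)) :=
      hρI.mono_measure (Measure.restrict_mono (Set.Ioi_subset_Ioi hT) le_rfl)
    have hone : ∀ s u : ℝ, 0 < s → 0 ≤ u → u ≤ s → ∫ ω, M u s ω ∂P = 1 := by
      intro s u hs hu hus
      rw [← integral_condExp (ℱ.le 0), integral_congr_ae (hMmart s 0 u hs le_rfl hu hus),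
        integral_congr_ae (hMinit s hs)]
      simp
    have hF : ∀ u, 0 ≤ u → u ≤ T → Integrable (fun p : ℝ × Ω => ρ p.1 * M u p.1 p.2)
        ((volume.restrict (Set.Ioi T)).prod P) := by
      intro u hu huT
      have hmeas : Measurable (fun p : ℝ × Ω => ρ p.1 * M u p.1 p.2) :=
        (hρmeas.comp measurable_fst).mul
          (hMmeas.comp (measurable_const.prodMk (measurable_fst.prodMk measurable_snd)))
      rw [integrable_prod_iff hmeas.aestronglyMeasurable]
      constructor
      · filter_upwards [ae_restrict_mem measurableSet_Ioi] with s hs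
        have hs' : T < s := hs
        exact (hMint s u (by linarith) hu (by linarith)).const_mul _
      · refine hρT.congr ?_
        filter_upwards [ae_restrict_mem measurableSet_Ioi] with s hs
        have hs' : T < s := hs
        have hs0 : 0 < s := by linarith
        have : ∫ ω, ‖ρ s * M u s ω‖ ∂P = ∫ ω, ρ s * M u s ω ∂P := by
          refine integral_congr_ae ?_
          filter_upwards [hMpos s u hs0 hu (by linarith)] with ω hω
          exact Real.norm_of_nonneg (mul_pos (hρpos s hs0) hω).le
        rw [this, integral_const_mul, hone s u hs0 hu (by linarith), mul_one]
    have hX : ∀ u, 0 ≤ u → u ≤ T → Integrable (fun ω => ∫ s in Set.Ioi T, ρ s * M u s ω) P :=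
      fun u hu huT => (hF u hu huT).integral_prod_right
    refine Integrable.ae_eq_of_forall_setIntegral_eq _ _ integrable_condExp (hX t ht htT) ?_
    intro A hA _
    set g : Ω → ℝ := A.indicator (fun _ => (1 : ℝ)) with hgdef
    have hgi : Integrable g P := (integrable_const 1).indicator hA
    have hgb : ∀ ω, |g ω| ≤ 1 := by
      intro ω
      by_cases h : ω ∈ A <;> simp [hgdef, h]
    have hgb' : ∀ᵐ ω ∂P, ‖g ω‖ ≤ 1 := .of_forall hgb
    have hcb : ∀ᵐ ω ∂P, ‖(P[g | ℱ t]) ω‖ ≤ 1 := by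
      have := ae_bdd_abs_condExp_of_ae_bdd_abs (m := ℱ t) (μ := P) (R := 1) (f := g) (.of_forall hgb)
      exact this
    have hset : ∀ f : Ω → ℝ, ∫ ω in A, f ω ∂P = ∫ ω, g ω * f ω ∂P := by
      intro f
      rw [← integral_indicator hA]
      refine integral_congr_ae (.of_forall fun ω => ?_)
      by_cases h : ω ∈ A <;> simp [hgdef, h]
    rw [hset, hset, FH_aux_selfadj (ℱ.le t) g _ hgi hgb' hcb (hX T hT le_rfl),
      FH_aux_swap _ ρ (M T) (hF T hT le_rfl) _ integrable_condExp.1 hcb,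
      FH_aux_swap _ ρ (M t) (hF t ht htT) _ hgi.1 hgb']
    refine setIntegral_congr_fun measurableSet_Ioi fun s hs => ?_
    have hs' : T < s := hs
    have hs0 : 0 < s := by linarith
    rw [← FH_aux_selfadj (ℱ.le t) g _ hgi hgb' hcb (hMint s T hs0 hT hs'.le)]
    congr 1
    refine integral_congr_ae ?_
    filter_upwards [hMmart s t T hs0 ht htT hs'.le] with ω hω
    rw [hω]
  refine ⟨key, ?_⟩
  filter_upwards [key] with ω hω
  rw [hω]
end

section
/- Let m > 0, σ > 0, μ ∈ ℝ, t > 0, and set κ₁ = (μ + √(μ² + 2σ²m))/(2m) and κ₂ = (−μ + √(μ² + 2σ²m))/(2m). Let γ₁, γ₂ be independent random variables each with the Gamma distribution of shape mt and scale 1, let Γ have the Gamma distribution of shape mt and scale 1/m, and let Z be a standard normal random variable independent of Γ. Then the random variables κ₁γ₁ − κ₂γ₂ and μΓ + σ√Γ Z have the same distribution. -/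
open MeasureTheory ProbabilityTheory Real

lemma vg_gamma_lintegral_exp {a r t : ℝ} (ha : 0 < a) (hr : 0 < r) (ht : t < r) :
    ∫⁻ x, ENNReal.ofReal (Real.exp (t * x)) ∂(gammaMeasure a r)
      = ENNReal.ofReal ((1 - t / r) ^ (-a)) := by
  have hrt : 0 < r - t := by linarith
  have h1 : (1 - t / r) = (r - t) / r := by field_simp
  have hm : Measurable (gammaPDF a r) := (measurable_gammaPDFReal a r).ennreal_ofReal
  have hm2 : Measurable (gammaPDF a (r - t)) := (measurable_gammaPDFReal a _).ennreal_ofReal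
  rw [gammaMeasure, lintegral_withDensity_eq_lintegral_mul _ hm (by fun_prop)]
  have h2 : ∀ x, (gammaPDF a r * fun x => ENNReal.ofReal (Real.exp (t * x))) x
      = ENNReal.ofReal ((1 - t / r) ^ (-a)) * gammaPDF a (r - t) x := by
    intro x
    simp only [Pi.mul_apply, gammaPDF]
    rw [← ENNReal.ofReal_mul (gammaPDFReal_nonneg ha hr x),
      ← ENNReal.ofReal_mul (by rw [h1]; positivity)]
    congr 1
    unfold gammaPDFReal
    split_ifs with hx
    · rw [h1, Real.rpow_neg (by positivity), Real.div_rpow hrt.le hr.le]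
      have e : Real.exp (-((r - t) * x)) = Real.exp (-(r * x)) * Real.exp (t * x) := by
        rw [← Real.exp_add]; congr 1; ring
      rw [e]
      have := Real.rpow_pos_of_pos hrt a
      have := Real.rpow_pos_of_pos hr a
      have := Real.Gamma_pos_of_pos ha
      field_simp
    · simp
  rw [lintegral_congr h2, lintegral_const_mul _ hm2, lintegral_gammaPDF_eq_one ha hrt, mul_one]

lemma vg_gamma_integrable_exp {a r t : ℝ} (ha : 0 < a) (hr : 0 < r) (ht : t < r) :
    Integrable (fun x => Real.exp (t * x)) (gammaMeasure a r) := by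
  refine ⟨by fun_prop, ?_⟩
  rw [hasFiniteIntegral_iff_ofReal (ae_of_all _ fun x => (Real.exp_pos _).le),
    vg_gamma_lintegral_exp ha hr ht]
  exact ENNReal.ofReal_lt_top

lemma vg_gamma_mgf {a r t : ℝ} (ha : 0 < a) (hr : 0 < r) (ht : t < r) :
    mgf id (gammaMeasure a r) t = (1 - t / r) ^ (-a) := by
  have h1 : 0 < 1 - t / r := by
    rw [sub_pos, div_lt_one hr]; exact ht
  simp only [mgf, id]
  rw [integral_eq_lintegral_of_nonneg_ae (ae_of_all _ fun x => (Real.exp_pos _).le) (by fun_prop),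
    vg_gamma_lintegral_exp ha hr ht, ENNReal.toReal_ofReal (by positivity)]

lemma vg_gamma_complexMGF {a r : ℝ} (ha : 0 < a) (hr : 0 < r) {z : ℂ} (hz : z.re < r) :
    ∫ x : ℝ, Complex.exp (z * x) ∂(gammaMeasure a r) = (1 - z / r) ^ (-(a : ℂ)) := by
  have hsub : Set.Iio r ⊆ interior (integrableExpSet id (gammaMeasure a r)) :=
    interior_maximal (fun t ht => vg_gamma_integrable_exp ha hr ht) isOpen_Iio
  have hf : AnalyticOnNhd ℂ (complexMGF id (gammaMeasure a r)) {z | z.re < r} :=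
    fun z hz => analyticAt_complexMGF (hsub hz)
  have hg : AnalyticOnNhd ℂ (fun z : ℂ => (1 - z / r) ^ (-(a : ℂ))) {z | z.re < r} := by
    intro z hz
    refine AnalyticAt.cpow (by fun_prop) (by fun_prop) (Or.inl ?_)
    simp only [Complex.sub_re, Complex.one_re, Complex.div_ofReal_re, sub_pos, div_lt_one hr]
    exact hz
  have hU : IsPreconnected {z : ℂ | z.re < r} := (convex_halfSpace_re_lt r).isPreconnected
  have h0 : (0 : ℂ) ∈ {z : ℂ | z.re < r} := by simpa using hr
  have heq := hf.eqOn_of_preconnected_of_frequently_eq hg hU h0 ?_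
  · exact heq hz
  · have hreal : ∀ t : ℝ, t < r → complexMGF id (gammaMeasure a r) (t : ℂ)
        = (1 - (t : ℂ) / r) ^ (-(a : ℂ)) := by
      intro t ht
      have h1 : 0 < 1 - t / r := by
        rw [sub_pos, div_lt_one hr]; exact ht
      rw [complexMGF_ofReal, vg_gamma_mgf ha hr ht, Complex.ofReal_cpow h1.le]
      push_cast; rfl
    have htend : Filter.Tendsto (fun t : ℝ => (t : ℂ)) (nhdsWithin 0 {0}ᶜ)
        (nhdsWithin (0 : ℂ) {0}ᶜ) := by
      refine tendsto_nhdsWithin_iff.2 ⟨?_, ?_⟩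
      · have := (Complex.continuous_ofReal.tendsto (0 : ℝ)).mono_left
          (nhdsWithin_le_nhds (s := {0}ᶜ))
        simpa using this
      · filter_upwards [self_mem_nhdsWithin] with t ht
        simpa using ht
    refine htend.frequently ?_
    refine Filter.Eventually.frequently ?_
    filter_upwards [nhdsWithin_le_nhds (Iio_mem_nhds hr)] with t ht
    exact hreal t ht

/-- The variance gamma identity in law: with
`κ₁ = (μ + √(μ² + 2σ²m)) / (2m)` and `κ₂ = (-μ + √(μ² + 2σ²m)) / (2m)`, the
difference `κ₁ γ₁ - κ₂ γ₂` of independent `Gamma(mt, 1)` variables has the same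
distribution as the drifted subordinated variable `μ Γ + σ √Γ Z`, where
`Γ ~ Gamma(shape mt, scale 1/m)` and `Z` is standard normal independent of `Γ`. -/
theorem vg_identity_in_law
    {Ω : Type*} {m0 : MeasurableSpace Ω} {P : Measure Ω} [IsProbabilityMeasure P]
    (m σ μ t : ℝ) (hm : 0 < m) (hσ : 0 < σ) (ht : 0 < t)
    (κ₁ κ₂ : ℝ)
    (hκ₁ : κ₁ = (μ + Real.sqrt (μ ^ 2 + 2 * σ ^ 2 * m)) / (2 * m))
    (hκ₂ : κ₂ = (-μ + Real.sqrt (μ ^ 2 + 2 * σ ^ 2 * m)) / (2 * m))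
    (γ₁ γ₂ G Z : Ω → ℝ)
    (hmeas₁ : Measurable γ₁) (hmeas₂ : Measurable γ₂)
    (hmeasG : Measurable G) (hmeasZ : Measurable Z)
    (hindepγ : IndepFun γ₁ γ₂ P) (hindepGZ : IndepFun G Z P)
    (hlaw₁ : Measure.map γ₁ P = gammaMeasure (m * t) 1)
    (hlaw₂ : Measure.map γ₂ P = gammaMeasure (m * t) 1)
    (hlawG : Measure.map G P = gammaMeasure (m * t) m)
    (hlawZ : Measure.map Z P = gaussianReal 0 1) :
    Measure.map (fun ω => κ₁ * γ₁ ω - κ₂ * γ₂ ω) P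
      = Measure.map (fun ω => μ * G ω + σ * Real.sqrt (G ω) * Z ω) P := by
  have ha : 0 < m * t := mul_pos hm ht
  have hD : 0 ≤ μ ^ 2 + 2 * σ ^ 2 * m := by positivity
  have hS := Real.sq_sqrt hD
  have hdiff : κ₁ - κ₂ = μ / m := by rw [hκ₁, hκ₂]; field_simp; ring
  have hprod : κ₁ * κ₂ = σ ^ 2 / (2 * m) := by
    rw [hκ₁, hκ₂]; field_simp; linear_combination hS
  have mL : Measurable (fun ω => κ₁ * γ₁ ω - κ₂ * γ₂ ω) := by fun_prop
  have mR : Measurable (fun ω => μ * G ω + σ * Real.sqrt (G ω) * Z ω) := by fun_prop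
  have := Measure.isProbabilityMeasure_map (μ := P) mL.aemeasurable
  have := Measure.isProbabilityMeasure_map (μ := P) mR.aemeasurable
  apply Measure.ext_of_charFun
  ext s
  rw [charFun_apply_real, charFun_apply_real,
    integral_map mL.aemeasurable (by fun_prop), integral_map mR.aemeasurable (by fun_prop)]
  -- left side
  have hL : ∫ ω, Complex.exp (s * ((κ₁ * γ₁ ω - κ₂ * γ₂ ω : ℝ) : ℂ) * Complex.I) ∂P
      = (1 - (s * κ₁ * Complex.I) / (1 : ℝ)) ^ (-((m * t : ℝ) : ℂ))
        * (1 - (-(s * κ₂ * Complex.I)) / (1 : ℝ)) ^ (-((m * t : ℝ) : ℂ)) := by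
    have hind := hindepγ.comp (φ := fun x : ℝ => Complex.exp ((s * κ₁ * Complex.I) * x))
      (ψ := fun x : ℝ => Complex.exp ((-(s * κ₂ * Complex.I)) * x)) (by fun_prop) (by fun_prop)
    have h := hind.integral_fun_mul_eq_mul_integral
      (by apply Measurable.aestronglyMeasurable; fun_prop)
      (by apply Measurable.aestronglyMeasurable; fun_prop)
    have e1 := vg_gamma_complexMGF ha one_pos (z := s * κ₁ * Complex.I) (by simp)
    have e2 := vg_gamma_complexMGF ha one_pos (z := -(s * κ₂ * Complex.I)) (by simp)
    rw [← hlaw₁, integral_map hmeas₁.aemeasurable (by fun_prop)] at e1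
    rw [← hlaw₂, integral_map hmeas₂.aemeasurable (by fun_prop)] at e2
    rw [← e1, ← e2]
    simp only [Function.comp_apply] at h
    rw [← h]
    congr 1
    ext ω
    rw [← Complex.exp_add]
    congr 1
    push_cast; ring
  have hR : ∫ ω, Complex.exp (s * ((μ * G ω + σ * Real.sqrt (G ω) * Z ω : ℝ) : ℂ) * Complex.I) ∂P
      = (1 - (s * μ * Complex.I - σ ^ 2 * s ^ 2 / 2) / (m : ℝ)) ^ (-((m * t : ℝ) : ℂ)) := by
    have hmap := (indepFun_iff_map_prod_eq_prod_map_map hmeasG.aemeasurable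
      hmeasZ.aemeasurable).1 hindepGZ
    rw [hlawG, hlawZ] at hmap
    have := isProbabilityMeasure_gammaMeasure ha hm
    let F : ℝ × ℝ → ℂ := fun p =>
      Complex.exp (s * ((μ * p.1 + σ * Real.sqrt p.1 * p.2 : ℝ) : ℂ) * Complex.I)
    have hF : Measurable F := by fun_prop
    have e0 : ∫ ω, F (G ω, Z ω) ∂P = ∫ p, F p ∂((gammaMeasure (m * t) m).prod (gaussianReal 0 1)) := by
      rw [← hmap, integral_map (by fun_prop) hF.aestronglyMeasurable]
    have hFint : Integrable F ((gammaMeasure (m * t) m).prod (gaussianReal 0 1)) := by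
      refine Integrable.of_bound hF.aestronglyMeasurable 1 (ae_of_all _ fun p => ?_)
      simp only [F]
      rw [← Complex.ofReal_mul, Complex.norm_exp_ofReal_mul_I]
    have hpos : ∀ᵐ x ∂(gammaMeasure (m * t) m), 0 ≤ x := by
      have hmp : Measurable (gammaPDF (m * t) m) := (measurable_gammaPDFReal _ _).ennreal_ofReal
      rw [gammaMeasure, ae_withDensity_iff hmp]
      refine ae_of_all _ fun x hx => ?_
      by_contra hneg
      exact hx (gammaPDF_of_neg (not_le.1 hneg))
    change ∫ ω, F (G ω, Z ω) ∂P = _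
    rw [e0, integral_prod _ hFint, ← vg_gamma_complexMGF ha hm]
    · refine integral_congr_ae ?_
      filter_upwards [hpos] with x hx
      have hc := charFun_gaussianReal (μ := 0) (v := 1) (s * (σ * Real.sqrt x))
      rw [charFun_apply_real] at hc
      have e3 : ∀ y : ℝ, F (x, y) = Complex.exp (s * μ * Complex.I * x)
          * Complex.exp (((s * (σ * Real.sqrt x) : ℝ) : ℂ) * y * Complex.I) := by
        intro y
        simp only [F]
        rw [← Complex.exp_add]
        congr 1
        push_cast; ring
      simp_rw [e3]
      rw [integral_const_mul, hc, ← Complex.exp_add]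
      congr 1
      have hx2 : ((Real.sqrt x : ℝ) : ℂ) ^ 2 = x := by
        rw [← Complex.ofReal_pow, Real.sq_sqrt hx]
      push_cast
      linear_combination (-(s : ℂ) ^ 2 * σ ^ 2 / 2) * hx2
    · have : (s * μ * Complex.I - σ ^ 2 * s ^ 2 / 2 : ℂ)
          = ((-(σ ^ 2 * s ^ 2 / 2) : ℝ) : ℂ) + ((s * μ : ℝ) : ℂ) * Complex.I := by
        push_cast; ring
      rw [this, Complex.add_re, Complex.ofReal_re, Complex.re_ofReal_mul, Complex.I_re]
      nlinarith [sq_nonneg (σ * s)]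
  rw [hL, hR]
  -- the algebraic identity
  set x : ℂ := 1 - (s * κ₁ * Complex.I) / (1 : ℝ) with hx
  set y : ℂ := 1 - (-(s * κ₂ * Complex.I)) / (1 : ℝ) with hy
  have hxre : 0 < x.re := by simp [hx]
  have hyre : 0 < y.re := by simp [hy]
  have hx0 : x ≠ 0 := by intro h; simp [h] at hxre
  have hy0 : y ≠ 0 := by intro h; simp [h] at hyre
  have hxy : 1 - (s * μ * Complex.I - σ ^ 2 * s ^ 2 / 2) / (m : ℝ) = x * y := by
    have d : (κ₁ : ℂ) - κ₂ = μ / m := by exact_mod_cast hdiff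
    have p : (κ₁ : ℂ) * κ₂ = σ ^ 2 / (2 * m) := by exact_mod_cast hprod
    have hm' : (m : ℂ) ≠ 0 := by exact_mod_cast hm.ne'
    have q1 : (s * μ * Complex.I - σ ^ 2 * s ^ 2 / 2) / (m : ℂ)
        = s * Complex.I * (μ / m) - s ^ 2 * (σ ^ 2 / (2 * m)) := by field_simp
    rw [q1, ← d, ← p, hx, hy]
    push_cast
    linear_combination (s ^ 2 * κ₁ * κ₂ : ℂ) * Complex.I_sq
  have hargx := Complex.abs_arg_lt_pi_div_two_iff.2 (Or.inl hxre)
  have hargy := Complex.abs_arg_lt_pi_div_two_iff.2 (Or.inl hyre)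
  rw [abs_lt] at hargx hargy
  rw [hxy, Complex.cpow_def_of_ne_zero hx0, Complex.cpow_def_of_ne_zero hy0,
    Complex.cpow_def_of_ne_zero (mul_ne_zero hx0 hy0),
    Complex.log_mul hx0 hy0 ⟨by linarith [hargx.1, hargy.1], by linarith [hargx.2, hargy.2]⟩,
    ← Complex.exp_add]
  congr 1
  ring
end
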